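/- The Hausdorff dimension of the survivor set D_ε of the doubling map tends to 1 as ε → 0⁺; that is, lim_{ε→0⁺} dim_H(D_ε) = 1. -/

import Mathlib

open MeasureTheory Set Filter

noncomputable section

/-- The doubling map `x ↦ 2x mod 1` on `[0,1)`. -/
def doublingMap (x : ℝ) : ℝ := Int.fract (2 * x)

/-- The survivor set of the doubling map with hole `[0, ε]`. -/
def survivorSet (ε : ℝ) : Set ℝ :=
  {x ∈ Ico (0 : ℝ) 1 | ∀ k : ℕ, doublingMap^[k] x ∉ Icc 0 ε}

/-- The coding map: base `2^(m+1)` expansion with digits `e i + 1`, where `e i < 2^m`. -/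
def codeDigits (m : ℕ) (e : ℕ → Fin (2 ^ m)) : ℕ → Fin (2 ^ (m + 1)) :=
  fun i => ⟨(e i : ℕ) + 1, by
    have h := (e i).isLt
    have h2 : 0 < 2 ^ m := by positivity
    rw [pow_succ]; omega⟩

def code (m : ℕ) (e : ℕ → Fin (2 ^ m)) : ℝ := Real.ofDigits (codeDigits m e)

lemma code_step (m : ℕ) (e : ℕ → Fin (2 ^ m)) :
    2 ^ (m + 1) * code m e = ((e 0 : ℕ) : ℝ) + 1 + code m (fun i => e (i + 1)) := by
  have h := Real.ofDigits_eq_sum_add_ofDigits (codeDigits m e) 1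
  have h1 : Real.ofDigits (fun i => codeDigits m e (i + 1)) = code m (fun i => e (i + 1)) := rfl
  rw [h1] at h
  rw [code, h]
  simp only [Finset.sum_range_one, Real.ofDigitsTerm, codeDigits]
  push_cast
  field_simp

lemma code_nonneg (m : ℕ) (e : ℕ → Fin (2 ^ m)) : 0 ≤ code m e := Real.ofDigits_nonneg _

lemma code_lower (m : ℕ) (e : ℕ → Fin (2 ^ m)) : 1 ≤ 2 ^ (m + 1) * code m e := by
  rw [code_step]
  have := code_nonneg m (fun i => e (i + 1))
  have : (0 : ℝ) ≤ ((e 0 : ℕ) : ℝ) := by positivity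
  linarith

lemma code_upper (m : ℕ) (hm : 1 ≤ m) (e : ℕ → Fin (2 ^ m)) : code m e ≤ 3 / 4 := by
  have h := code_step m e
  have h1 : code m (fun i => e (i + 1)) ≤ 1 := Real.ofDigits_le_one _
  have h2 : ((e 0 : ℕ) : ℝ) + 1 ≤ 2 ^ m := by exact_mod_cast (e 0).isLt
  have h3 : (2 : ℝ) ≤ 2 ^ m := by
    calc (2 : ℝ) = 2 ^ 1 := by norm_num
      _ ≤ 2 ^ m := pow_le_pow_right₀ (by norm_num) hm
  rw [pow_succ] at h
  by_contra hc
  push Not at hc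
  nlinarith

lemma code_sep (m : ℕ) (hm : 1 ≤ m) (n : ℕ) : ∀ e e' : ℕ → Fin (2 ^ m),
    (∀ i < n, e i = e' i) → e n ≠ e' n →
    1 ≤ 4 * (2 ^ (m + 1)) ^ (n + 1) * |code m e - code m e'| := by
  have hB : (0 : ℝ) < 2 ^ (m + 1) := by positivity
  induction n with
  | zero =>
    intro e e' _ hne
    have h := code_step m e
    have h' := code_step m e'
    have a1 := code_nonneg m (fun i => e (i + 1))
    have a2 := code_nonneg m (fun i => e' (i + 1))
    have b1 := code_upper m hm (fun i => e (i + 1))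
    have b2 := code_upper m hm (fun i => e' (i + 1))
    have hne' : ((e 0 : ℕ)) ≠ (e' 0 : ℕ) := fun hh => hne (Fin.ext hh)
    have key : 1 / 4 ≤ |2 ^ (m + 1) * code m e - 2 ^ (m + 1) * code m e'| := by
      rw [h, h']
      rcases lt_or_gt_of_ne hne' with hl | hl
      · have : ((e 0 : ℕ) : ℝ) + 1 ≤ ((e' 0 : ℕ) : ℝ) := by exact_mod_cast hl
        rw [le_abs]; right; linarith
      · have : ((e' 0 : ℕ) : ℝ) + 1 ≤ ((e 0 : ℕ) : ℝ) := by exact_mod_cast hl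
        rw [le_abs]; left; linarith
    rw [← mul_sub, abs_mul, abs_of_pos hB] at key
    rw [zero_add, pow_one]
    linarith
  | succ n ih =>
    intro e e' heq hne
    have h0 := heq 0 (by omega)
    have := ih (fun i => e (i + 1)) (fun i => e' (i + 1)) (fun i hi => heq (i + 1) (by omega)) hne
    have h := code_step m e
    have h' := code_step m e'
    have key : code m (fun i => e (i + 1)) - code m (fun i => e' (i + 1)) =
        2 ^ (m + 1) * (code m e - code m e') := by
      rw [mul_sub, h, h', h0]; ring
    rw [key, abs_mul, abs_of_pos hB] at this
    rw [pow_succ _ (n + 1)]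
    linarith

lemma exists_first_diff {α : Type*} {e e' : ℕ → α} (h : e ≠ e') :
    ∃ n, (∀ i < n, e i = e' i) ∧ e n ≠ e' n := by
  classical
  have hex : ∃ n, e n ≠ e' n := Function.ne_iff.mp h
  exact ⟨Nat.find hex, fun i hi => not_not.mp (Nat.find_min hex hi), Nat.find_spec hex⟩

lemma code_injective (m : ℕ) (hm : 1 ≤ m) : Function.Injective (code m) := by
  intro e e' h
  by_contra hne
  obtain ⟨n, h1, h2⟩ := exists_first_diff hne
  have := code_sep m hm n e e' h1 h2
  rw [h] at this
  norm_num at this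

lemma code_holder (m : ℕ) (hm : 1 ≤ m) (e e' : ℕ → Fin (2 ^ m)) :
    |Real.ofDigits e - Real.ofDigits e'| ≤
      (4 * 2 ^ (m + 1) : ℝ) ^ ((m : ℝ) / (m + 1)) *
        |code m e - code m e'| ^ ((m : ℝ) / (m + 1)) := by
  by_cases hne : e = e'
  · subst hne
    simp only [sub_self, abs_zero]
    positivity
  obtain ⟨n, h1, h2⟩ := exists_first_diff hne
  have hs := code_sep m hm n e e' h1 h2
  refine (Real.abs_ofDigits_sub_ofDigits_le h1).trans ?_
  rw [← Real.mul_rpow (by positivity) (abs_nonneg _)]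
  have hle : ((2 : ℝ) ^ ((m + 1) * n))⁻¹ ≤ 4 * 2 ^ (m + 1) * |code m e - code m e'| := by
    rw [inv_le_iff_one_le_mul₀ (by positivity), pow_mul]
    rw [pow_succ] at hs
    linarith
  calc (((2 ^ m : ℕ) : ℝ) ^ n)⁻¹ = (((2 : ℝ) ^ ((m + 1) * n))⁻¹) ^ ((m : ℝ) / (m + 1)) := by
        rw [Real.inv_rpow (by positivity), ← Real.rpow_natCast 2 ((m + 1) * n),
          ← Real.rpow_mul (by norm_num)]
        have : (((m + 1) * n : ℕ) : ℝ) * ((m : ℝ) / (m + 1)) = ((m * n : ℕ) : ℝ) := by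
          push_cast; field_simp
        rw [this, Real.rpow_natCast]
        push_cast
        rw [pow_mul]
    _ ≤ _ := Real.rpow_le_rpow (by positivity) hle (by positivity)

lemma le_dimH_range_code (m : ℕ) (hm : 1 ≤ m) :
    (((m : NNReal) / (m + 1) : NNReal) : ENNReal) ≤ dimH (range (code m)) := by
  set r : NNReal := (m : NNReal) / (m + 1) with hr
  have hr0 : 0 < r := by
    have : (0 : NNReal) < m := by exact_mod_cast hm
    positivity
  have hrr : (r : ℝ) = (m : ℝ) / (m + 1) := by rw [hr]; push_cast; rfl
  let f : ℝ → ℝ := fun x => Real.ofDigits (Function.invFun (code m) x)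
  have hf : ∀ e, f (code m e) = Real.ofDigits e := fun e => by
    simp only [f]
    rw [Function.leftInverse_invFun (code_injective m hm) e]
  have hH : HolderOnWith (Real.toNNReal ((4 * 2 ^ (m + 1) : ℝ) ^ ((m : ℝ) / (m + 1)))) r f
      (range (code m)) := by
    rintro _ ⟨e, rfl⟩ _ ⟨e', rfl⟩
    rw [hf, hf, edist_dist, edist_dist, ENNReal.ofReal_rpow_of_nonneg dist_nonneg r.coe_nonneg]
    change _ ≤ ENNReal.ofReal _ * _
    rw [← ENNReal.ofReal_mul (by positivity), hrr]
    exact ENNReal.ofReal_le_ofReal (code_holder m hm e e')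
  have h1 := hH.dimH_image_le hr0
  have h2 : Icc (0 : ℝ) 1 ⊆ f '' range (code m) := by
    intro y hy
    have hb : 1 < 2 ^ m := Nat.one_lt_two_pow (by omega)
    obtain ⟨e, -, he⟩ := Real.ofDigits_SurjOn hb hy
    exact ⟨code m e, ⟨e, rfl⟩, by rw [hf, he]⟩
  have h3 : dimH (Icc (0 : ℝ) 1) = 1 := by
    rw [Real.dimH_of_nonempty_interior (by rw [interior_Icc]; exact nonempty_Ioo.2 one_pos)]
    simp
  have h4 : 1 ≤ dimH (range (code m)) / r := h3 ▸ (dimH_mono h2).trans h1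
  rw [ENNReal.le_div_iff_mul_le (Or.inl (by exact_mod_cast hr0.ne')) (Or.inl ENNReal.coe_ne_top),
    one_mul] at h4
  exact h4

lemma doublingMap_iterate (x : ℝ) (k : ℕ) :
    doublingMap^[k + 1] x = Int.fract (2 ^ (k + 1) * x) := by
  induction k with
  | zero => simp [doublingMap]
  | succ k ih =>
    rw [Function.iterate_succ_apply', ih, doublingMap, Int.fract_eq_fract]
    refine ⟨-(2 * ⌊2 ^ (k + 1) * x⌋), ?_⟩
    rw [Int.fract]
    push_cast
    ring

lemma doublingMap_iterate_le (x : ℝ) (hx : 0 ≤ x) (k : ℕ) :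
    doublingMap^[k] x ≤ 2 ^ k * x := by
  cases k with
  | zero => simp
  | succ k =>
    rw [doublingMap_iterate, Int.fract]
    have : (0 : ℝ) ≤ (⌊2 ^ (k + 1) * x⌋ : ℝ) := by
      exact_mod_cast Int.floor_nonneg.2 (by positivity)
    linarith

lemma doublingMap_code (m : ℕ) (hm : 1 ≤ m) (e : ℕ → Fin (2 ^ m)) :
    doublingMap^[m + 1] (code m e) = code m (fun i => e (i + 1)) := by
  rw [doublingMap_iterate, code_step, Int.fract_eq_iff]
  refine ⟨code_nonneg _ _, by linarith [code_upper m hm (fun i => e (i + 1))],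
    (e 0 : ℕ) + 1, ?_⟩
  push_cast
  ring

lemma doublingMap_code_iterate (m : ℕ) (hm : 1 ≤ m) (j : ℕ) : ∀ e : ℕ → Fin (2 ^ m),
    ∃ e', doublingMap^[(m + 1) * j] (code m e) = code m e' := by
  induction j with
  | zero => exact fun e => ⟨e, by simp⟩
  | succ j ih =>
    intro e
    obtain ⟨e', he'⟩ := ih (fun i => e (i + 1))
    refine ⟨e', ?_⟩
    rw [mul_add, mul_one, Function.iterate_add_apply, doublingMap_code m hm, he']

lemma range_code_subset (m : ℕ) (hm : 1 ≤ m) (ε : ℝ)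
    (hε : 2 ^ (m + 1) * (2 ^ (m + 1) * ε) < 1) : range (code m) ⊆ survivorSet ε := by
  rintro _ ⟨e, rfl⟩
  refine ⟨⟨code_nonneg _ _, by linarith [code_upper m hm e]⟩, ?_⟩
  intro k hk
  obtain ⟨e', he'⟩ := doublingMap_code_iterate m hm (k / (m + 1) + 1) e
  have hlt : k % (m + 1) < m + 1 := Nat.mod_lt _ (by omega)
  have hdm := Nat.div_add_mod k (m + 1)
  have hsplit : (m + 1) * (k / (m + 1) + 1) = (m + 1 - k % (m + 1)) + k := by
    rw [mul_add]; omega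
  rw [hsplit, Function.iterate_add_apply] at he'
  have h1 := doublingMap_iterate_le _ hk.1 (m + 1 - k % (m + 1))
  have h2 : (2 : ℝ) ^ (m + 1 - k % (m + 1)) ≤ 2 ^ (m + 1) :=
    pow_le_pow_right₀ (by norm_num) (by omega)
  have h3 : code m e' ≤ 2 ^ (m + 1) * ε := by
    rw [← he']
    exact h1.trans (mul_le_mul h2 hk.2 hk.1 (by positivity))
  have h4 := code_lower m e'
  have h5 : (2 : ℝ) ^ (m + 1) * code m e' ≤ 2 ^ (m + 1) * (2 ^ (m + 1) * ε) := by gcongr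
  linarith

/-- `dim_H D_ε → 1` as `ε → 0⁺`. -/
theorem tendsto_dimH_survivorSet_doubling :
    Tendsto (fun ε : ℝ => dimH (survivorSet ε)) (nhdsWithin 0 (Ioi 0)) (nhds 1) := by
  rw [tendsto_order]
  constructor
  · intro a ha
    have hlim : Tendsto (fun m : ℕ => (((m : NNReal) / (m + 1) : NNReal) : ENNReal)) atTop
        (nhds 1) := by
      rw [← ENNReal.coe_one, ENNReal.tendsto_coe, ← NNReal.tendsto_coe]
      push_cast
      exact tendsto_natCast_div_add_atTop (1 : ℝ)
    obtain ⟨m, ham, hm⟩ := ((hlim.eventually_const_lt ha).and (eventually_ge_atTop 1)).exists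
    have hcont : Tendsto (fun ε : ℝ => (2 : ℝ) ^ (m + 1) * (2 ^ (m + 1) * ε))
        (nhdsWithin 0 (Ioi 0)) (nhds 0) := by
      have : Continuous (fun ε : ℝ => (2 : ℝ) ^ (m + 1) * (2 ^ (m + 1) * ε)) := by fun_prop
      have h := this.tendsto 0
      simp only [mul_zero] at h
      exact h.mono_left nhdsWithin_le_nhds
    filter_upwards [hcont.eventually_lt_const one_pos] with ε hε
    exact ham.trans_le ((le_dimH_range_code m hm).trans
      (dimH_mono (range_code_subset m hm ε hε)))
  · intro a ha
    refine Eventually.of_forall fun ε => lt_of_le_of_lt ?_ ha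
    exact (dimH_mono (subset_univ _)).trans Real.dimH_univ.le
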